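/- Let α, β, γ, δ ∈ ℝ with α + δ ≠ 0 and αγ + βδ = 0. For the Lie algebra 𝔤₅ with its Bott connection ∇^B and symmetrized Ricci tensor ρ̃^B, the triple (𝔤₅, ∇^B, ρ̃^B) IS a quasi-statistical structure; that is, (∇^B_X ρ̃^B)(Y,Z) − (∇^B_Y ρ̃^B)(X,Z) + ρ̃^B(T^B(X,Y), Z) = 0 for all X, Y, Z ∈ V. -/

import Mathlib

noncomputable section

/-- The underlying vector space `V = ℝ³`. -/
abbrev V : Type := Fin 3 → ℝ

/-- The basis vector e₁. -/
def e1 : V := ![1, 0, 0]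
/-- The basis vector e₂. -/
def e2 : V := ![0, 1, 0]
/-- The basis vector e₃. -/
def e3 : V := ![0, 0, 1]

/-- The Lorentzian inner product with g(e₁,e₁)=g(e₂,e₂)=1, g(e₃,e₃)=−1. -/
def gL (x y : V) : ℝ := x 0 * y 0 + x 1 * y 1 - x 2 * y 2

/-- Curvature R(X,Y)Z = ∇_X ∇_Y Z − ∇_Y ∇_X Z − ∇_{[X,Y]} Z. -/
def curv (nabla bracket : V → V → V) (x y z : V) : V :=
  nabla x (nabla y z) - nabla y (nabla x z) - nabla (bracket x y) z

/-- Ricci tensor ρ(X,Y) = −g(R(X,e₁)Y,e₁) − g(R(X,e₂)Y,e₂) + g(R(X,e₃)Y,e₃). -/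
def ricci (nabla bracket : V → V → V) (x y : V) : ℝ :=
  - gL (curv nabla bracket x e1 y) e1 - gL (curv nabla bracket x e2 y) e2
  + gL (curv nabla bracket x e3 y) e3

/-- Symmetrized Ricci tensor ρ̃(X,Y) = (ρ(X,Y) + ρ(Y,X))/2. -/
def ricciSym (nabla bracket : V → V → V) (x y : V) : ℝ :=
  (ricci nabla bracket x y + ricci nabla bracket y x) / 2

/-- Covariant derivative of a (left-invariant) bilinear form:
(∇_X ω)(Y,Z) = −ω(∇_X Y, Z) − ω(Y, ∇_X Z). -/
def covDer (nabla : V → V → V) (ω : V → V → ℝ) (x y z : V) : ℝ :=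
  - ω (nabla x y) z - ω y (nabla x z)

/-- ω is a Codazzi tensor for ∇: (∇_X ω)(Y,Z) = (∇_Y ω)(X,Z) for all X,Y,Z. -/
def IsCodazzi (nabla : V → V → V) (ω : V → V → ℝ) : Prop :=
  ∀ x y z : V, covDer nabla ω x y z = covDer nabla ω y x z

/-- Torsion T(X,Y) = ∇_X Y − ∇_Y X − [X,Y]. -/
def torsion (nabla bracket : V → V → V) (x y : V) : V :=
  nabla x y - nabla y x - bracket x y

/-- (V,∇,ω) is a quasi-statistical structure:
(∇_X ω)(Y,Z) − (∇_Y ω)(X,Z) + ω(T(X,Y),Z) = 0 for all X,Y,Z. -/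
def IsQuasiStatistical (nabla bracket : V → V → V) (ω : V → V → ℝ) : Prop :=
  ∀ x y z : V,
    covDer nabla ω x y z - covDer nabla ω y x z + ω (torsion nabla bracket x y) z = 0

/-- The Lie bracket of the Lie algebra 𝔤5. -/
def bracket (α β γ δ : ℝ) (x y : V) : V :=
  ![ (x 0 * y 2 - x 2 * y 0) * (α) + (x 1 * y 2 - x 2 * y 1) * (γ),
     (x 0 * y 2 - x 2 * y 0) * (β) + (x 1 * y 2 - x 2 * y 1) * (δ),
     (0:ℝ) ]

/-- The Bott connection ∇^B of 𝔤5. -/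
def nabla (α β γ δ : ℝ) (x y : V) : V :=
  ![ x 2 * y 0 * (-α) + x 2 * y 1 * (-γ),
     x 2 * y 0 * (-β) + x 2 * y 1 * (-δ),
     (0:ℝ) ]

/-- The Bott connection of 𝔤₅ is flat. -/
theorem curv_nabla_bracket (α β γ δ : ℝ) (x y z : V) :
    curv (nabla α β γ δ) (bracket α β γ δ) x y z = 0 := by
  ext i
  fin_cases i <;> simp [curv, nabla, bracket] <;> ring

/-- The symmetrized Ricci tensor of the Bott connection of 𝔤₅ vanishes. -/
theorem ricciSym_nabla_bracket (α β γ δ : ℝ) (x y : V) :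
    ricciSym (nabla α β γ δ) (bracket α β γ δ) x y = 0 := by
  simp [ricciSym, ricci, curv_nabla_bracket, gL]

theorem stmt10 (α β γ δ : ℝ) (h1 : α + δ ≠ 0) (h2 : α * γ + β * δ = 0) :
    IsQuasiStatistical (nabla α β γ δ) (bracket α β γ δ) (ricciSym (nabla α β γ δ) (bracket α β γ δ)) := by
  intro x y z
  simp [covDer, ricciSym_nabla_bracket]

end
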